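/- Let L be a finite geometric lattice of rank at most 2. Then: (i) for every ring R with 1 and every atomic datum D over R with respect to L, the minimal complex O(D, L) is acyclic; (ii) if R is a field, then every atomic datum D over R with respect to L is L-contractible. -/

import Mathlib

/-- A finite lattice is atomistic: every element is a join (finite sup) of atoms. -/
def Atomistic (L : Type*) [Lattice L] [OrderBot L] : Prop :=
  ∀ x : L, ∃ s : Finset L, (∀ a ∈ s, IsAtom a) ∧ s.sup id = x

/-- Semimodularity: whenever `a ⊓ b` is covered by `a`, `b` is covered by `a ⊔ b`. -/
def Semimodular (L : Type*) [Lattice L] : Prop :=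
  ∀ a b : L, a ⊓ b ⋖ a → b ⋖ a ⊔ b

/-- `rk` is the rank function: it vanishes at `⊥` and increases by one along covers. -/
def IsRankFunction {L : Type*} [Lattice L] [OrderBot L] (rk : L → ℕ) : Prop :=
  rk ⊥ = 0 ∧ ∀ x y : L, x ⋖ y → rk y = rk x + 1

/-- An element `x ≠ ⊥` is decomposable if `x = y ⊔ z` with `y, z ≠ ⊥` such that every atom
below `x` lies below exactly one of `y` and `z`. -/
def Decomposable {L : Type*} [Lattice L] [OrderBot L] (x : L) : Prop :=
  ∃ y z : L, y ≠ ⊥ ∧ z ≠ ⊥ ∧ y ⊔ z = x ∧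
    ∀ a : L, IsAtom a → a ≤ x → Xor' (a ≤ y) (a ≤ z)

/-- An element is indecomposable if it is `≠ ⊥` and not decomposable. -/
def Indecomposable {L : Type*} [Lattice L] [OrderBot L] (x : L) : Prop :=
  x ≠ ⊥ ∧ ¬ Decomposable x

section ComplexDefs

variable {R : Type*} [Ring R] {L : Type*} [Lattice L] [BoundedOrder L]

/-- A compatible `L`-grading on a chain complex `(V, d)` of `R`-modules:
`d` squares to zero, the graded piece `V_x` lives in degree `rk x` (we record a piece in every
degree, which is `⊥` off the rank), each degree is the internal direct sum of its pieces, and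
the differential maps `V_x` into `⊕_{y ⋖ x} V_y`. -/
def IsCompatGrading [DecidableEq L] (rk : L → ℕ) (V : ℕ → Type*)
    [∀ i, AddCommGroup (V i)] [∀ i, Module R (V i)]
    (d : ∀ i, V (i + 1) →ₗ[R] V i) (Vx : L → ∀ i, Submodule R (V i)) : Prop :=
  (∀ (i : ℕ) (v : V (i + 2)), d i (d (i + 1) v) = 0) ∧
  (∀ (x : L) (i : ℕ), i ≠ rk x → Vx x i = ⊥) ∧
  (∀ i : ℕ, DirectSum.IsInternal (fun x : L => Vx x i)) ∧
  (∀ (i : ℕ) (x : L), rk x = i + 1 →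
    Submodule.map (d i) (Vx x (i + 1)) ≤ ⨆ y ∈ {y : L | y ⋖ x}, Vx y i)

/-- The degree-`i` part of the subcomplex `V_{≤ x}`. -/
def Vle {V : ℕ → Type*} [∀ i, AddCommGroup (V i)] [∀ i, Module R (V i)]
    (Vx : L → ∀ i, Submodule R (V i)) (x : L) (i : ℕ) : Submodule R (V i) :=
  ⨆ y ∈ {y : L | y ≤ x}, Vx y i

/-- Acyclicity of the subcomplex `V_{≤x}`: `Ker ∂_j = Im ∂_{j+1}` at all positions `j ≥ 1`. -/
def AcyclicOn {V : ℕ → Type*} [∀ i, AddCommGroup (V i)] [∀ i, Module R (V i)]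
    (d : ∀ i, V (i + 1) →ₗ[R] V i) (Vx : L → ∀ i, Submodule R (V i)) (x : L) : Prop :=
  ∀ i : ℕ, Vle Vx x (i + 1) ⊓ LinearMap.ker (d i) =
    Submodule.map (d (i + 1)) (Vle Vx x (i + 2))

/-- Acyclicity of the complex: `Ker ∂_j = Im ∂_{j+1}` at all positions `j ≥ 1`. -/
def Acyclic {V : ℕ → Type*} [∀ i, AddCommGroup (V i)] [∀ i, Module R (V i)]
    (d : ∀ i, V (i + 1) →ₗ[R] V i) : Prop :=
  ∀ i : ℕ, LinearMap.ker (d i) = LinearMap.range (d (i + 1))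

/-- `(V, d, Vx)` is the minimal complex of its atomic datum `(V_⊥, (∂(V_a))_a)`:
the bottom piece is everything in degree `0`, the differential is injective on each atom piece,
and for `rk x ≥ 2` the differential is injective on `V_x` with image exactly the kernel of
`∂` on `V_{≺x} = ⊕_{y ⋖ x} V_y`. -/
def IsMinimal (rk : L → ℕ) {V : ℕ → Type*} [∀ i, AddCommGroup (V i)] [∀ i, Module R (V i)]
    (d : ∀ i, V (i + 1) →ₗ[R] V i) (Vx : L → ∀ i, Submodule R (V i)) : Prop :=
  Vx ⊥ 0 = ⊤ ∧
  (∀ a : L, IsAtom a → ∀ v ∈ Vx a 1, d 0 v = 0 → v = 0) ∧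
  (∀ (i : ℕ) (x : L), rk x = i + 2 →
    (∀ v ∈ Vx x (i + 2), d (i + 1) v = 0 → v = 0) ∧
    Submodule.map (d (i + 1)) (Vx x (i + 2)) =
      (⨆ y ∈ {y : L | y ⋖ x}, Vx y (i + 1)) ⊓ LinearMap.ker (d i))

/-- The subcomplex `V_{≤x}` admits an `L_{≤x}`-homotopy: a contracting homotopy
(`h0` on the image of `∂_1`, `h j` in positions `j ≥ 1`) which moves each graded piece `V_z`
(`⊥ ≠ z ≤ x`) into `⊕_{y ⋗ z, y ≤ x} V_y`. -/
def HasLHomotopyOn (rk : L → ℕ) {V : ℕ → Type*} [∀ i, AddCommGroup (V i)]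
    [∀ i, Module R (V i)] (d : ∀ i, V (i + 1) →ₗ[R] V i)
    (Vx : L → ∀ i, Submodule R (V i)) (x : L) : Prop :=
  ∃ (hmem : ∀ (i : ℕ) (v : V (i + 1)), v ∈ Vle Vx x (i + 1) → d i v ∈ Vle Vx x i)
    (h0 : ↥(Submodule.map (d 0) (Vle Vx x 1)) →ₗ[R] V 1)
    (h : ∀ i : ℕ, ↥(Vle Vx x (i + 1)) →ₗ[R] V (i + 2)),
    (∀ v : ↥(Vle Vx x 1),
      d 1 (h 0 v) + h0 ⟨d 0 v.1, Submodule.mem_map_of_mem v.2⟩ = v.1) ∧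
    (∀ (i : ℕ) (v : ↥(Vle Vx x (i + 2))),
      d (i + 2) (h (i + 1) v) + h i ⟨d (i + 1) v.1, hmem (i + 1) v.1 v.2⟩ = v.1) ∧
    (∀ (i : ℕ) (z : L), z ≤ x → rk z = i + 1 →
      ∀ v : ↥(Vle Vx x (i + 1)), v.1 ∈ Vx z (i + 1) →
        h i v ∈ ⨆ y ∈ {y : L | z ⋖ y ∧ y ≤ x}, Vx y (i + 2))

/-- The complex is `L`-contractible: every subcomplex `V_{≤x}` admits an `L_{≤x}`-homotopy. -/
def LContractible (rk : L → ℕ) {V : ℕ → Type*} [∀ i, AddCommGroup (V i)]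
    [∀ i, Module R (V i)] (d : ∀ i, V (i + 1) →ₗ[R] V i)
    (Vx : L → ∀ i, Submodule R (V i)) : Prop :=
  ∀ x : L, HasLHomotopyOn rk d Vx x

end ComplexDefs

/-- A function that increases by one along covers of a finite lattice is strictly monotone. -/
theorem IsRankFunction.strictMono {L : Type*} [Lattice L] [Finite L] [OrderBot L] {rk : L → ℕ}
    (hrk : IsRankFunction rk) : StrictMono rk := by
  classical
  have := Fintype.ofFinite L
  let _ : LocallyFiniteOrder L := Fintype.toLocallyFiniteOrder
  intro a b hab
  induction lt_iff_transGen_covBy.1 hab with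
  | single h => have := hrk.2 _ _ h; omega
  | tail h' h ih =>
    have := hrk.2 _ _ h
    have := ih (lt_iff_transGen_covBy.2 h')
    omega

theorem IsRankFunction.covBy_of_lt {L : Type*} [Lattice L] [Finite L] [OrderBot L] {rk : L → ℕ}
    (hrk : IsRankFunction rk) {x y : L} (hxy : x < y) (h : rk y ≤ rk x + 1) : x ⋖ y := by
  refine ⟨hxy, fun c hxc hcy => ?_⟩
  have := hrk.strictMono hxc
  have := hrk.strictMono hcy
  omega

theorem IsRankFunction.isAtom {L : Type*} [Lattice L] [Finite L] [OrderBot L] {rk : L → ℕ}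
    (hrk : IsRankFunction rk) {x : L} (h : rk x = 1) : IsAtom x := by
  rw [← bot_covBy_iff]
  refine hrk.covBy_of_lt (bot_lt_iff_ne_bot.2 ?_) (by omega)
  rintro rfl
  have := hrk.1
  omega

section GradedComplexes

variable {R : Type*} [Ring R] {L : Type*} [Lattice L]
  {V : ℕ → Type*} [∀ i, AddCommGroup (V i)] [∀ i, Module R (V i)]
  {d : ∀ i, V (i + 1) →ₗ[R] V i} {Vx : L → ∀ i, Submodule R (V i)} {rk : L → ℕ}

/-- Only the pieces of rank `i` contribute to the degree-`i` part of `V_{≤ x}`. -/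
theorem Vle_le_of_rank {x : L} {i : ℕ} {p : Submodule R (V i)}
    (hVx : ∀ (x : L) (i : ℕ), i ≠ rk x → Vx x i = ⊥)
    (h : ∀ y ≤ x, rk y = i → Vx y i ≤ p) : Vle Vx x i ≤ p := by
  refine iSup₂_le fun y hy => ?_
  by_cases hi : rk y = i
  · exact h y hy hi
  · rw [hVx y i (Ne.symm hi)]
    exact bot_le

theorem le_Vle {x y : L} (h : y ≤ x) (i : ℕ) : Vx y i ≤ Vle Vx x i :=
  le_iSup₂_of_le (f := fun y (_ : y ∈ {y : L | y ≤ x}) => Vx y i) y h le_rfl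

variable [DecidableEq L]

/-- `V_{≤ x}` is a subcomplex. -/
theorem IsCompatGrading.map_mem_Vle (hV : IsCompatGrading rk V d Vx) (x : L) (i : ℕ)
    (v : V (i + 1)) (hv : v ∈ Vle Vx x (i + 1)) : d i v ∈ Vle Vx x i := by
  have h : Vle Vx x (i + 1) ≤ (Vle Vx x i).comap (d i) := by
    refine Vle_le_of_rank hV.2.1 fun y hy hi => ?_
    rw [← Submodule.map_le_iff_le_comap]
    exact (hV.2.2.2 i y hi).trans (iSup₂_le fun z hz => le_Vle (hz.le.trans hy) i)
  exact h hv

variable [BoundedOrder L]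

theorem IsCompatGrading.Vle_top (hV : IsCompatGrading rk V d Vx) (i : ℕ) :
    Vle Vx ⊤ i = ⊤ := by
  rw [eq_top_iff, ← (hV.2.2.1 i).submodule_iSup_eq_top]
  exact iSup_le fun y => le_Vle le_top i

variable [Finite L]

theorem IsCompatGrading.eq_zero_of_rank_lt (hV : IsCompatGrading rk V d Vx)
    (hrk : IsRankFunction rk) {x : L} {i : ℕ} (hi : rk x < i) {v : V i}
    (hv : v ∈ Vle Vx x i) : v = 0 := by
  have h : Vle Vx x i ≤ ⊥ := Vle_le_of_rank hV.2.1 fun y hy h => by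
    have := hrk.strictMono.monotone hy
    omega
  exact (Submodule.mem_bot R).1 (h hv)

theorem IsCompatGrading.Vle_rank (hV : IsCompatGrading rk V d Vx)
    (hrk : IsRankFunction rk) {x : L} {i : ℕ} (hi : rk x = i) : Vle Vx x i = Vx x i := by
  refine le_antisymm (Vle_le_of_rank hV.2.1 fun y hy h => ?_) (le_Vle le_rfl i)
  obtain rfl | hlt := hy.eq_or_lt
  · exact le_rfl
  · have := hrk.strictMono hlt
    omega

/-- In a minimal complex, `∂_2` is injective on `V_{≤ x}` when `rk x ≤ 2`. -/
theorem IsMinimal.eq_zero_of_map_eq_zero (hmin : IsMinimal rk d Vx)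
    (hV : IsCompatGrading rk V d Vx) (hrk : IsRankFunction rk) {x : L} (hx : rk x ≤ 2)
    {v : V 2} (hv : v ∈ Vle Vx x 2) (h : d 1 v = 0) : v = 0 := by
  obtain hx | hx := hx.lt_or_eq
  · exact hV.eq_zero_of_rank_lt hrk hx hv
  · rw [hV.Vle_rank hrk hx] at hv
    exact (hmin.2.2 0 x hx).1 v hv h

/-- In a minimal complex, `V_{≤ x}` is exact in degree `1` when `rk x ≤ 2`. -/
theorem IsMinimal.exists_map_eq (hmin : IsMinimal rk d Vx)
    (hV : IsCompatGrading rk V d Vx) (hrk : IsRankFunction rk) {x : L} (hx : rk x ≤ 2)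
    {v : V 1} (hv : v ∈ Vle Vx x 1) (h : d 0 v = 0) : ∃ u ∈ Vle Vx x 2, d 1 u = v := by
  obtain hx | hx := hx.lt_or_eq
  · refine ⟨0, zero_mem _, ?_⟩
    rw [map_zero, eq_comm]
    obtain hx | hx := (Nat.le_of_lt_succ hx).lt_or_eq
    · exact hV.eq_zero_of_rank_lt hrk hx hv
    · rw [hV.Vle_rank hrk hx] at hv
      exact hmin.2.1 x (hrk.isAtom hx) v hv h
  · have hle : Vle Vx x 1 ≤ ⨆ y ∈ {y : L | y ⋖ x}, Vx y 1 :=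
      Vle_le_of_rank hV.2.1 fun y hy hy1 => by
        have hyx : y ⋖ x := hrk.covBy_of_lt (lt_of_le_of_ne hy (by rintro rfl; omega)) (by omega)
        exact le_iSup₂_of_le (f := fun y (_ : y ∈ {y : L | y ⋖ x}) => Vx y 1) y hyx le_rfl
    have hv' : v ∈ Submodule.map (d 1) (Vx x 2) := by
      rw [(hmin.2.2 0 x hx).2]
      exact ⟨hle hv, h⟩
    obtain ⟨u, hu, rfl⟩ := hv'
    exact ⟨u, le_Vle le_rfl 2 hu, rfl⟩

theorem IsMinimal.acyclic_of_rank_le_two (hmin : IsMinimal rk d Vx)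
    (hV : IsCompatGrading rk V d Vx) (hrk : IsRankFunction rk) (hrank : rk ⊤ ≤ 2) :
    Acyclic d := by
  have htop (i : ℕ) (v : V i) : v ∈ Vle Vx (⊤ : L) i := by
    rw [hV.Vle_top]
    trivial
  intro i
  refine le_antisymm (fun v hv => ?_) ?_
  · rw [LinearMap.mem_ker] at hv
    match i, v, hv with
    | 0, v, hv =>
      obtain ⟨u, -, rfl⟩ := hmin.exists_map_eq hV hrk hrank (htop 1 v) hv
      exact ⟨u, rfl⟩
    | 1, v, hv =>
      rw [hmin.eq_zero_of_map_eq_zero hV hrk hrank (htop 2 v) hv]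
      exact zero_mem _
    | i + 2, v, hv =>
      rw [hV.eq_zero_of_rank_lt hrk (by omega) (htop _ v)]
      exact zero_mem _
  · rintro _ ⟨u, rfl⟩
    exact hV.1 i u

/-- If `rk x ≤ 2`, every element of rank one below `x` is covered by every element of rank two
below `x`. -/
theorem IsCompatGrading.Vle_two_le (hV : IsCompatGrading rk V d Vx) (hrk : IsRankFunction rk)
    {x z : L} (hx : rk x ≤ 2) (hzx : z ≤ x) (hz : rk z = 1) :
    Vle Vx x 2 ≤ ⨆ y ∈ {y : L | z ⋖ y ∧ y ≤ x}, Vx y 2 := by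
  refine Vle_le_of_rank hV.2.1 fun y hy hy2 => ?_
  obtain rfl | hlt := hy.eq_or_lt
  · have hzy : z ⋖ y := hrk.covBy_of_lt (lt_of_le_of_ne hzx (by rintro rfl; omega)) (by omega)
    exact le_iSup₂_of_le (f := fun w (_ : w ∈ {w : L | z ⋖ w ∧ w ≤ y}) => Vx w 2) y
      ⟨hzy, le_rfl⟩ le_rfl
  · have := hrk.strictMono hlt
    omega

end GradedComplexes

theorem IsMinimal.hasLHomotopyOn_of_rank_le_two {K : Type*} [DivisionRing K] {L : Type*}
    [Lattice L] [BoundedOrder L] [DecidableEq L] [Finite L]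
    {V : ℕ → Type*} [∀ i, AddCommGroup (V i)] [∀ i, Module K (V i)]
    {d : ∀ i, V (i + 1) →ₗ[K] V i} {Vx : L → ∀ i, Submodule K (V i)} {rk : L → ℕ}
    (hmin : IsMinimal rk d Vx) (hV : IsCompatGrading rk V d Vx) (hrk : IsRankFunction rk)
    {x : L} (hx : rk x ≤ 2) : HasLHomotopyOn rk d Vx x := by
  let g := (d 0).submoduleMap (Vle Vx x 1)
  obtain ⟨s, hs⟩ := g.exists_rightInverse_of_surjective
    (LinearMap.range_eq_top.2 ((d 0).submoduleMap_surjective _))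
  let e : Vle Vx x 2 →ₗ[K] Vle Vx x 1 := (d 1).restrict (hV.map_mem_Vle x 1)
  obtain ⟨l, hl⟩ := e.exists_leftInverse_of_injective (LinearMap.ker_eq_bot'.2 fun v hv =>
    Subtype.ext (hmin.eq_zero_of_map_eq_zero hV hrk hx v.2 (congrArg Subtype.val hv)))
  have hle (v) : l (e v) = v := LinearMap.congr_fun hl v
  have hgs (v) : g (s v) = v := LinearMap.congr_fun hs v
  let h₀ : Vle Vx x 1 →ₗ[K] V 2 := (Vle Vx x 2).subtype ∘ₗ l ∘ₗ (LinearMap.id - s ∘ₗ g)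
  let h : ∀ i : ℕ, Vle Vx x (i + 1) →ₗ[K] V (i + 2)
    | 0 => h₀
    | _ + 1 => 0
  refine ⟨hV.map_mem_Vle x, (Vle Vx x 1).subtype ∘ₗ s, h, fun v => ?_, fun i v => ?_,
    fun i z hzx hz v hv => ?_⟩
  · have hker : d 0 (v - s (g v)).1 = 0 :=
      congrArg Subtype.val (show g (v - s (g v)) = 0 by rw [map_sub, hgs, sub_self])
    obtain ⟨u, hu, huv⟩ := hmin.exists_map_eq hV hrk hx (v - s (g v)).2 hker
    have heu : e ⟨u, hu⟩ = v - s (g v) := Subtype.ext huv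
    change d 1 (l (v - s (g v))).1 + (s (g v)).1 = v.1
    rw [← heu, hle, huv, Submodule.coe_sub, sub_add_cancel]
  · match i, v with
    | 0, v =>
      have hgv : g (e v) = 0 := Subtype.ext (hV.1 0 v)
      change d 2 0 + (l (e v - s (g (e v)))).1 = v.1
      rw [hgv, map_zero, map_zero, sub_zero, hle, zero_add]
    | i + 1, v =>
      have hv : v.1 = 0 := hV.eq_zero_of_rank_lt hrk (by omega) v.2
      change d (i + 3) 0 + 0 = v.1
      rw [hv, map_zero, add_zero]
  · match i, hz, v with
    | 0, hz, v => exact hV.Vle_two_le hrk hx hzx hz (l (v - s (g v))).2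
    | i + 1, _, v => exact zero_mem _

/-- For a finite geometric lattice of rank at most 2: (i) over any ring, every minimal complex
of an atomic datum is acyclic; (ii) over any field, every such minimal complex is
`L`-contractible (i.e. every atomic datum is `L`-contractible). -/
theorem stmt8 {L : Type*} [Lattice L] [Fintype L] [DecidableEq L] [BoundedOrder L]
    (hatom : Atomistic L) (hsemi : Semimodular L)
    (rk : L → ℕ) (hrk : IsRankFunction rk) (hrank2 : rk ⊤ ≤ 2) :
    (∀ (R : Type*) [Ring R] (V : ℕ → Type*) [∀ i, AddCommGroup (V i)] [∀ i, Module R (V i)]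
      (d : ∀ i, V (i + 1) →ₗ[R] V i) (Vx : L → ∀ i, Submodule R (V i)),
      IsCompatGrading rk V d Vx → IsMinimal rk d Vx → Acyclic d) ∧
    (∀ (K : Type*) [Field K] (V : ℕ → Type*) [∀ i, AddCommGroup (V i)] [∀ i, Module K (V i)]
      (d : ∀ i, V (i + 1) →ₗ[K] V i) (Vx : L → ∀ i, Submodule K (V i)),
      IsCompatGrading rk V d Vx → IsMinimal rk d Vx → LContractible rk d Vx) := by
  refine ⟨fun R _ V _ _ d Vx hV hmin => hmin.acyclic_of_rank_le_two hV hrk hrank2,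
    fun K _ V _ _ d Vx hV hmin x => hmin.hasLHomotopyOn_of_rank_le_two hV hrk ?_⟩
  exact (hrk.strictMono.monotone le_top).trans hrank2
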